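/- arXiv:1602.03253 — 7 statements merged into one kernel-verified Lean document; each statement's English description precedes it below -/
import Mathlib

section
/- Let p and q be smooth, everywhere positive probability densities on ℝ^d with score functions s_p = ∇ log p and s_q = ∇ log q, and let f : ℝ^d → ℝ be a smooth function in the Stein class of p such that x ↦ (s_q(x) f(x) + ∇f(x)) p(x) is integrable. Then ∫_{ℝ^d} (s_q(x) f(x) + ∇_x f(x)) p(x) dx = ∫_{ℝ^d} (s_q(x) − s_p(x)) f(x) p(x) dx in ℝ^d. -/
open MeasureTheory Real
open scoped RealInnerProductSpace

noncomputable section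

/-- Abbreviation for Euclidean space `ℝ^d`. -/
abbrev Eu (d : ℕ) := EuclideanSpace ℝ (Fin d)

/-- The Stein score function `s_p = ∇ₓ log p`. -/
def score {d : ℕ} (p : Eu d → ℝ) (x : Eu d) : Eu d :=
  gradient (fun y => Real.log (p y)) x

/-- `f` is in the Stein class of `p` : the map `x ↦ ∇ₓ(f x * p x)` is (Lebesgue) integrable
on `ℝ^d` and its integral vanishes (componentwise, i.e. as a vector in `ℝ^d`). -/
def SteinClass {d : ℕ} (p f : Eu d → ℝ) : Prop :=
  MeasureTheory.Integrable (fun x => gradient (fun y => f y * p y) x) ∧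
    (∫ x, gradient (fun y => f y * p y) x) = 0


theorem HasGradientAt.mul {F : Type*} [NormedAddCommGroup F] [InnerProductSpace ℝ F]
    [CompleteSpace F] {f g : F → ℝ} {f' g' x : F}
    (hf : HasGradientAt f f' x) (hg : HasGradientAt g g' x) :
    HasGradientAt (fun y => f y * g y) (f x • g' + g x • f') x := by
  rw [hasGradientAt_iff_hasFDerivAt] at *
  simpa using hf.fun_mul hg

theorem HasGradientAt.log {F : Type*} [NormedAddCommGroup F] [InnerProductSpace ℝ F]
    [CompleteSpace F] {f : F → ℝ} {f' x : F} (hf : HasGradientAt f f' x) (hx : f x ≠ 0) :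
    HasGradientAt (fun y => Real.log (f y)) ((f x)⁻¹ • f') x := by
  rw [hasGradientAt_iff_hasFDerivAt] at *
  simpa using hf.log hx

/-- For smooth positive densities `p, q` on `ℝ^d` and a smooth `f` in the Stein class of `p`
with integrable Stein-operator integrand,
`∫ (s_q f + ∇f) p = ∫ (s_q − s_p) f p` in `ℝ^d`. -/
theorem expectation_stein_operator {d : ℕ} (p q f : Eu d → ℝ)
    (hp : ContDiff ℝ (⊤ : ℕ∞) p) (hq : ContDiff ℝ (⊤ : ℕ∞) q)
    (hppos : ∀ x, 0 < p x) (hqpos : ∀ x, 0 < q x)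
    (hpint : (∫ x, p x) = 1) (hqint : (∫ x, q x) = 1)
    (hf : ContDiff ℝ (⊤ : ℕ∞) f) (hfstein : SteinClass p f)
    (hint : MeasureTheory.Integrable (fun x => p x • (f x • score q x + gradient f x))) :
    (∫ x, p x • (f x • score q x + gradient f x))
      = ∫ x, p x • (f x • (score q x - score p x)) := by
  have key (x : Eu d) : p x • (f x • (score q x - score p x)) =
      p x • (f x • score q x + gradient f x) - gradient (fun y => f y * p y) x := by
    have hgp := (hp.differentiable (by simp) x).hasGradientAt
    have hgf := (hf.differentiable (by simp) x).hasGradientAt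
    have hscore : score p x = (p x)⁻¹ • gradient p x :=
      (hgp.log (hppos x).ne').gradient
    rw [(hgf.mul hgp).gradient, hscore]
    have hx := (hppos x).ne'
    match_scalars <;> field_simp
    ring
  simp_rw [key]
  rw [integral_sub hint hfstein.1, hfstein.2, sub_zero]
end
end

section
/- Let p and q be smooth, everywhere positive probability densities on ℝ^d with score functions s_p = ∇ log p and s_q = ∇ log q, and let f : ℝ^d → ℝ^d be a smooth vector-valued function each of whose components f_ℓ is in the Stein class of p, such that x ↦ (s_q(x)ᵀ f(x) + div f(x)) p(x) is integrable. Then ∫_{ℝ^d} (s_q(x)ᵀ f(x) + div_x f(x)) p(x) dx = ∫_{ℝ^d} (s_q(x) − s_p(x))ᵀ f(x) p(x) dx. -/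
open MeasureTheory Real
open scoped RealInnerProductSpace

noncomputable section

/-- Divergence of a vector field `f : ℝ^d → ℝ^d` : `div f x = ∑ ℓ, ∂f_ℓ/∂x_ℓ`. -/
def diverg {d : ℕ} (f : Eu d → Eu d) (x : Eu d) : ℝ :=
  ∑ ℓ, fderiv ℝ (fun y => f y ℓ) x (EuclideanSpace.single ℓ 1)


lemma gradient_apply_eq_fderiv_single {d : ℕ} (g : Eu d → ℝ) (x : Eu d) (ℓ : Fin d) :
    gradient g x ℓ = fderiv ℝ g x (EuclideanSpace.single ℓ 1) := by
  rw [← inner_gradient_left, EuclideanSpace.inner_single_right]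
  simp

lemma score_apply_mul {d : ℕ} {p : Eu d → ℝ} {x : Eu d} (hp : DifferentiableAt ℝ p x)
    (hx : p x ≠ 0) (ℓ : Fin d) :
    score p x ℓ * p x = fderiv ℝ p x (EuclideanSpace.single ℓ 1) := by
  rw [score, gradient_apply_eq_fderiv_single, (hp.hasFDerivAt.log hx).fderiv]
  simp only [smul_apply, smul_eq_mul]
  field_simp

/-- The product rule `∑ ℓ, ∂(f_ℓ p)/∂x_ℓ = (s_pᵀ f + div f) p`. -/
lemma sum_gradient_mul_apply {d : ℕ} {p : Eu d → ℝ} {f : Eu d → Eu d} {x : Eu d}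
    (hp : DifferentiableAt ℝ p x) (hx : p x ≠ 0) (hf : DifferentiableAt ℝ f x) :
    ∑ ℓ, gradient (fun y => f y ℓ * p y) x ℓ = (⟪score p x, f x⟫ + diverg f x) * p x := by
  have hfc : ∀ ℓ : Fin d, DifferentiableAt ℝ (fun y => f y ℓ) x := fun ℓ =>
    (EuclideanSpace.proj (𝕜 := ℝ) ℓ).differentiableAt.comp x hf
  rw [PiLp.inner_apply, diverg, ← Finset.sum_add_distrib, Finset.sum_mul]
  refine Finset.sum_congr rfl fun ℓ _ => ?_
  rw [gradient_apply_eq_fderiv_single, fderiv_fun_mul (hfc ℓ) hp]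
  simp only [add_apply, smul_apply, smul_eq_mul,
    ← score_apply_mul hp hx, RCLike.inner_apply, conj_trivial]
  ring

/-- The components of `x ↦ ∇ₓ(g x * p x)` integrate to zero for `g` in the Stein class of `p`. -/
lemma SteinClass.integrable_and_integral_apply {d : ℕ} {p g : Eu d → ℝ} (h : SteinClass p g)
    (ℓ : Fin d) :
    Integrable (fun x => gradient (fun y => g y * p y) x ℓ) ∧
      ∫ x, gradient (fun y => g y * p y) x ℓ = 0 := by
  refine ⟨(EuclideanSpace.proj (𝕜 := ℝ) ℓ).integrable_comp h.1, ?_⟩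
  have := (EuclideanSpace.proj (𝕜 := ℝ) ℓ).integral_comp_comm h.1
  rw [h.2, map_zero] at this
  exact this

/-- Vector-valued version: for smooth positive densities `p, q` on `ℝ^d` and a smooth
vector field `f : ℝ^d → ℝ^d` whose components are in the Stein class of `p`,
`∫ (s_qᵀ f + div f) p = ∫ (s_q − s_p)ᵀ f p`. -/
theorem expectation_stein_operator_vector {d : ℕ} (p q : Eu d → ℝ) (f : Eu d → Eu d)
    (hp : ContDiff ℝ (⊤ : ℕ∞) p) (hq : ContDiff ℝ (⊤ : ℕ∞) q)
    (hppos : ∀ x, 0 < p x) (hqpos : ∀ x, 0 < q x)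
    (hpint : (∫ x, p x) = 1) (hqint : (∫ x, q x) = 1)
    (hf : ContDiff ℝ (⊤ : ℕ∞) f)
    (hfstein : ∀ ℓ : Fin d, SteinClass p (fun x => f x ℓ))
    (hint : MeasureTheory.Integrable (fun x => (⟪score q x, f x⟫ + diverg f x) * p x)) :
    (∫ x, (⟪score q x, f x⟫ + diverg f x) * p x)
      = ∫ x, ⟪score q x - score p x, f x⟫ * p x := by
  have key : ∀ x, ⟪score q x - score p x, f x⟫ * p x
      = (⟪score q x, f x⟫ + diverg f x) * p x
        - ∑ ℓ, gradient (fun y => f y ℓ * p y) x ℓ := fun x => by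
    rw [sum_gradient_mul_apply (hp.differentiable (by simp) x) (hppos x).ne'
      (hf.differentiable (by simp) x), inner_sub_left]
    ring
  simp_rw [key]
  have hg := fun ℓ => (hfstein ℓ).integrable_and_integral_apply ℓ
  rw [integral_sub hint (integrable_finsetSum _ fun ℓ _ => (hg ℓ).1),
    integral_finsetSum _ fun ℓ _ => (hg ℓ).1, Finset.sum_eq_zero fun ℓ _ => (hg ℓ).2, sub_zero]
end
end

section
/- Let p and q be smooth, everywhere positive probability densities on ℝ^d (each integrating to 1), let δ(x) = s_q(x) − s_p(x) be the score difference, and suppose each component of g(x) = p(x)·δ(x) is square-integrable on ℝ^d. Let k : ℝ^d × ℝ^d → ℝ be an integrally strictly positive definite kernel, i.e. for every measurable g₀ : ℝ^d → ℝ with 0 < ∫ g₀² < ∞ we have ∬ g₀(x) k(x,x') g₀(x') dx dx' > 0, and assume the kernelized Stein discrepancy S(p,q) = ∬ δ(x)ᵀ k(x,x') δ(x') p(x) p(x') dx dx' is well-defined (the integrand is integrable). Then S(p,q) ≥ 0, and S(p,q) = 0 if and only if p = q. -/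
open MeasureTheory Real
open scoped RealInnerProductSpace

noncomputable section

theorem continuous_score {d : ℕ} {p : Eu d → ℝ} (hp : ContDiff ℝ (⊤ : ℕ∞) p)
    (hppos : ∀ x, 0 < p x) : Continuous (score p) :=
  (InnerProductSpace.toDual ℝ (Eu d)).symm.continuous.comp
    ((hp.log fun x => (hppos x).ne').continuous_fderiv (by simp))

/-- Smooth positive functions with the same score and the same nonzero integral are equal. -/
theorem eq_of_score_eq {d : ℕ} {p q : Eu d → ℝ}
    (hp : ContDiff ℝ (⊤ : ℕ∞) p) (hq : ContDiff ℝ (⊤ : ℕ∞) q)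
    (hppos : ∀ x, 0 < p x) (hqpos : ∀ x, 0 < q x)
    (hpq : (∫ x, p x) = ∫ x, q x) (hp0 : (∫ x, p x) ≠ 0)
    (h : score p = score q) : p = q := by
  have hlp : Differentiable ℝ fun x => Real.log (p x) :=
    (hp.log fun x => (hppos x).ne').differentiable (by simp)
  have hlq : Differentiable ℝ fun x => Real.log (q x) :=
    (hq.log fun x => (hqpos x).ne').differentiable (by simp)
  have hfd : ∀ x, fderiv ℝ (fun x => Real.log (q x) - Real.log (p x)) x = 0 := fun x => by
    rw [fderiv_fun_sub (hlq x) (hlp x), sub_eq_zero]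
    exact ((InnerProductSpace.toDual ℝ (Eu d)).symm.injective (congrFun h x)).symm
  have hconst := is_const_of_fderiv_eq_zero (hlq.sub hlp) hfd
  have hmul : ∀ x, q x = Real.exp (Real.log (q 0) - Real.log (p 0)) * p x := fun x => by
    have hx : Real.log (q x) - Real.log (p x) = Real.log (q 0) - Real.log (p 0) := hconst x 0
    rw [← hx, Real.exp_sub, Real.exp_log (hqpos x), Real.exp_log (hppos x),
      div_mul_cancel₀ _ (hppos x).ne']
  have hone : Real.exp (Real.log (q 0) - Real.log (p 0)) = 1 := by
    rw [integral_congr_ae (.of_forall hmul), integral_const_mul] at hpq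
    exact (mul_eq_right₀ hp0).1 hpq.symm
  funext x
  rw [hmul x, hone, one_mul]

/-- A function of square integral zero makes the quadratic form of any kernel vanish a.e. -/
theorem kernel_form_ae_eq_zero {α : Type*} [MeasurableSpace α] {μ : Measure α} [SFinite μ]
    (k : α → α → ℝ) {g : α → ℝ} (hg : g =ᵐ[μ] 0) :
    (fun z : α × α => g z.1 * k z.1 z.2 * g z.2) =ᵐ[μ.prod μ] 0 := by
  filter_upwards [Measure.quasiMeasurePreserving_fst.ae hg] with z hz
  simp_all

/-- If the quadratic form of `k` is positive on functions of positive finite square integral, then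
it is integrable and nonnegative on square-integrable functions, and it is definite. -/
theorem kernel_form_integrable_nonneg_definite {α : Type*} [MeasurableSpace α] {μ : Measure α}
    [SFinite μ] {k : α → α → ℝ}
    (hispd : ∀ g : α → ℝ, Measurable g → Integrable (fun x => (g x) ^ 2) μ →
      (0 < ∫ x, (g x) ^ 2 ∂μ) →
      (0 < ∫ z : α × α, g z.1 * k z.1 z.2 * g z.2 ∂(μ.prod μ)))
    {g : α → ℝ} (hg : Measurable g) (hg2 : Integrable (fun x => (g x) ^ 2) μ) :
    Integrable (fun z : α × α => g z.1 * k z.1 z.2 * g z.2) (μ.prod μ) ∧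
      (0 ≤ ∫ z : α × α, g z.1 * k z.1 z.2 * g z.2 ∂(μ.prod μ)) ∧
      ((∫ z : α × α, g z.1 * k z.1 z.2 * g z.2 ∂(μ.prod μ)) = 0 → g =ᵐ[μ] 0) := by
  have hnn : 0 ≤ fun x => (g x) ^ 2 := fun x => sq_nonneg (g x)
  rcases (integral_nonneg hnn : 0 ≤ ∫ x, (g x) ^ 2 ∂μ).lt_or_eq with hpos | hzero
  · have h := hispd g hg hg2 hpos
    exact ⟨.of_integral_ne_zero h.ne', h.le, fun h0 => absurd h0 h.ne'⟩
  · have hae : g =ᵐ[μ] 0 := by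
      filter_upwards [(integral_eq_zero_iff_of_nonneg hnn hg2).1 hzero.symm] with x hx
      exact pow_eq_zero_iff two_ne_zero |>.1 hx
    have hform := kernel_form_ae_eq_zero k hae
    exact ⟨(integrable_zero _ _ _).congr hform.symm, (integral_eq_zero_of_ae hform).ge,
      fun _ => hae⟩

/-- **KSD is a valid discrepancy.** For smooth positive probability densities `p, q` on `ℝ^d`
with `g = p·(s_q − s_p)` square-integrable componentwise, and `k` an integrally strictly
positive definite kernel, the kernelized Stein discrepancy
`S(p,q) = ∬ δ(x)ᵀ k(x,x') δ(x') p(x) p(x') dx dx'` satisfies `S(p,q) ≥ 0`, with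
`S(p,q) = 0` iff `p = q`. -/
theorem ksd_nonneg_and_eq_zero_iff {d : ℕ} (p q : Eu d → ℝ) (k : Eu d → Eu d → ℝ)
    (hp : ContDiff ℝ (⊤ : ℕ∞) p) (hq : ContDiff ℝ (⊤ : ℕ∞) q)
    (hppos : ∀ x, 0 < p x) (hqpos : ∀ x, 0 < q x)
    (hpint : (∫ x, p x) = 1) (hqint : (∫ x, q x) = 1)
    (hk : Measurable (fun z : Eu d × Eu d => k z.1 z.2))
    (hg2 : ∀ ℓ : Fin d,
      MeasureTheory.Integrable (fun x => (p x * (score q x - score p x) ℓ) ^ 2))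
    (hispd : ∀ g₀ : Eu d → ℝ, Measurable g₀ →
      MeasureTheory.Integrable (fun x => (g₀ x) ^ 2) → (0 < ∫ x, (g₀ x) ^ 2) →
      (0 < ∫ z : Eu d × Eu d, g₀ z.1 * k z.1 z.2 * g₀ z.2 ∂(volume.prod volume)))
    (hS : MeasureTheory.Integrable (fun z : Eu d × Eu d =>
        k z.1 z.2 * ⟪score q z.1 - score p z.1, score q z.2 - score p z.2⟫ *
          (p z.1 * p z.2)) (volume.prod volume)) :
    (0 ≤ ∫ z : Eu d × Eu d,
        k z.1 z.2 * ⟪score q z.1 - score p z.1, score q z.2 - score p z.2⟫ *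
          (p z.1 * p z.2) ∂(volume.prod volume)) ∧
      ((∫ z : Eu d × Eu d,
        k z.1 z.2 * ⟪score q z.1 - score p z.1, score q z.2 - score p z.2⟫ *
          (p z.1 * p z.2) ∂(volume.prod volume)) = 0 ↔ p = q) := by
  set g : Fin d → Eu d → ℝ := fun ℓ x => p x * (score q x - score p x) ℓ with hg
  have hgc : ∀ ℓ, Continuous (g ℓ) := fun ℓ =>
    hp.continuous.mul <| (EuclideanSpace.proj (𝕜 := ℝ) ℓ).continuous.comp <|
      (continuous_score hq hqpos).sub (continuous_score hp hppos)
  have hform ℓ := kernel_form_integrable_nonneg_definite hispd (hgc ℓ).measurable (hg2 ℓ)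
  have hsum : (∫ z : Eu d × Eu d,
      k z.1 z.2 * ⟪score q z.1 - score p z.1, score q z.2 - score p z.2⟫ *
        (p z.1 * p z.2) ∂(volume.prod volume)) =
      ∑ ℓ, ∫ z : Eu d × Eu d, g ℓ z.1 * k z.1 z.2 * g ℓ z.2 ∂(volume.prod volume) := by
    rw [← integral_finsetSum _ fun ℓ _ => (hform ℓ).1]
    congr with z
    simp only [PiLp.inner_apply, Finset.mul_sum, Finset.sum_mul, hg]
    refine Finset.sum_congr rfl fun ℓ _ => ?_
    simp only [RCLike.inner_apply, conj_trivial]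
    ring
  rw [hsum]
  refine ⟨Finset.sum_nonneg fun ℓ _ => (hform ℓ).2.1, fun h => ?_, fun h => ?_⟩
  · rw [Finset.sum_eq_zero_iff_of_nonneg fun ℓ _ => (hform ℓ).2.1] at h
    refine eq_of_score_eq hp hq hppos hqpos (hpint.trans hqint.symm) (by simp [hpint]) ?_
    ext x ℓ
    have h0 : g ℓ = 0 := (hgc ℓ).ae_eq_iff_eq volume continuous_zero |>.1
      ((hform ℓ).2.2 (h ℓ (Finset.mem_univ ℓ)))
    have hx : p x * (score q x - score p x) ℓ = 0 := congrFun h0 x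
    have hx' : score q x ℓ - score p x ℓ = 0 := (mul_eq_zero.1 hx).resolve_left (hppos x).ne'
    exact (sub_eq_zero.1 hx').symm
  · subst h
    simp [hg]
end
end

section
/- Let p be a smooth, everywhere positive probability density on ℝ^d and let k : ℝ^d × ℝ^d → ℝ have continuous second-order partial derivatives. Fix an index ℓ and a point x'₀ ∈ ℝ^d. Suppose that for every x' in a neighborhood of x'₀ the function x ↦ k(x,x') is in the Stein class of p (so ∫ ∇_x(p(x) k(x,x')) dx = 0), that for each fixed x the map x' ↦ ∇_x(p(x)k(x,x')) is differentiable, and that there is an integrable function G : ℝ^d → ℝ with ‖∂_{x'_ℓ} ∇_x(p(x) k(x,x'))‖ ≤ G(x) for all x and all x' in that neighborhood. Then ∫ ∇_x(p(x) · ∂_{x'_ℓ} k(x,x'₀)) dx = 0; that is, x ↦ ∂_{x'_ℓ} k(x,x'₀) is in the Stein class of p. -/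
open MeasureTheory Real
open scoped RealInnerProductSpace

noncomputable section

/-- For a `C²` function `H` of two variables, differentiating the gradient in the first variable
along `e` in the second variable gives the gradient of the derivative along `e`. -/
lemma fderiv_gradient_fst_apply {E F : Type*}
    [NormedAddCommGroup E] [InnerProductSpace ℝ E] [CompleteSpace E]
    [NormedAddCommGroup F] [NormedSpace ℝ F] {H : E × F → ℝ} (hH : ContDiff ℝ 2 H)
    (x : E) (y e : F) :
    fderiv ℝ (fun y' => gradient (fun u => H (u, y')) x) y e =
      gradient (fun u => fderiv ℝ (fun w => H (u, w)) y e) x := by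
  have hd : Differentiable ℝ H := hH.differentiable (by norm_num)
  have hd2 : Differentiable ℝ (fderiv ℝ H) :=
    (hH.fderiv_right (m := 1) (by norm_num)).differentiable (by norm_num)
  have hfst (y' : F) (u : E) : HasFDerivAt (fun u => H (u, y'))
      ((fderiv ℝ H (u, y')).comp (ContinuousLinearMap.inl ℝ E F)) u :=
    (hd (u, y')).hasFDerivAt.comp u (hasFDerivAt_prodMk_left u y')
  have hsnd (u : E) (w : F) : HasFDerivAt (fun w => H (u, w))
      ((fderiv ℝ H (u, w)).comp (ContinuousLinearMap.inr ℝ E F)) w :=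
    (hd (u, w)).hasFDerivAt.comp w (hasFDerivAt_prodMk_right u w)
  have hleft : HasFDerivAt
      (fun y' => (fderiv ℝ H (x, y')).comp (ContinuousLinearMap.inl ℝ E F))
      (((ContinuousLinearMap.compL ℝ E (E × F) ℝ).flip (ContinuousLinearMap.inl ℝ E F)).comp
        ((fderiv ℝ (fderiv ℝ H) (x, y)).comp (ContinuousLinearMap.inr ℝ E F))) y :=
    ((ContinuousLinearMap.compL ℝ E (E × F) ℝ).flip
      (ContinuousLinearMap.inl ℝ E F)).hasFDerivAt.comp y
      ((hd2 (x, y)).hasFDerivAt.comp y (hasFDerivAt_prodMk_right x y))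
  have hright : HasFDerivAt (fun u => fderiv ℝ H (u, y) (0, e))
      ((ContinuousLinearMap.apply ℝ ℝ ((0, e) : E × F)).comp
        ((fderiv ℝ (fderiv ℝ H) (x, y)).comp (ContinuousLinearMap.inl ℝ E F))) x :=
    (ContinuousLinearMap.apply ℝ ℝ ((0, e) : E × F)).hasFDerivAt.comp x
      ((hd2 (x, y)).hasFDerivAt.comp x (hasFDerivAt_prodMk_left x y))
  have hsymm : IsSymmSndFDerivAt ℝ H (x, y) :=
    hH.contDiffAt.isSymmSndFDerivAt (by simp)
  let L : StrongDual ℝ E →L[ℝ] E :=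
    { toFun := (InnerProductSpace.toDual ℝ E).symm
      map_add' := map_add _
      map_smul' := by simp
      cont := (InnerProductSpace.toDual ℝ E).symm.continuous }
  have hgrad : (fun y' => gradient (fun u => H (u, y')) x) =
      L ∘ fun y' => (fderiv ℝ H (x, y')).comp (ContinuousLinearMap.inl ℝ E F) :=
    funext fun y' => congrArg L (hfst y' x).fderiv
  rw [hgrad, (L.hasFDerivAt.comp y hleft).fderiv]
  simp only [gradient, (hsnd _ y).fderiv, ContinuousLinearMap.comp_apply,
    ContinuousLinearMap.inr_apply, hright.fderiv]
  refine congrArg (InnerProductSpace.toDual ℝ E).symm ?_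
  ext v
  simpa using hsymm (0, e) (v, 0)

/-- The gradient of any function on `ℝ^d` is strongly measurable. -/
lemma stronglyMeasurable_gradient {d : ℕ} (f : Eu d → ℝ) :
    StronglyMeasurable (fun x => gradient f x) :=
  ((InnerProductSpace.toDual ℝ (Eu d)).symm.continuous.measurable.comp
    (measurable_fderiv ℝ f)).stronglyMeasurable

/-- If `x ↦ k(x,x')` is in the Stein class of `p` for all `x'` near `x'₀`, and differentiation
under the integral sign is justified by a dominating integrable function `G`, then the partial
derivative `x ↦ ∂_{x'_ℓ} k(x, x'₀)` is also in the Stein class of `p`. -/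
theorem deriv_kernel_mem_steinClass {d : ℕ} (p : Eu d → ℝ) (k : Eu d → Eu d → ℝ)
    (hp : ContDiff ℝ (⊤ : ℕ∞) p) (hppos : ∀ x, 0 < p x)
    (hk : ContDiff ℝ 2 (fun z : Eu d × Eu d => k z.1 z.2))
    (ℓ : Fin d) (x'₀ : Eu d) (s : Set (Eu d)) (hs : s ∈ nhds x'₀)
    (hstein : ∀ x' ∈ s, SteinClass p (fun x => k x x'))
    (hdiff : ∀ (x : Eu d), ∀ x' ∈ s,
      DifferentiableAt ℝ (fun y' => gradient (fun y => k y y' * p y) x) x')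
    (G : Eu d → ℝ) (hG : MeasureTheory.Integrable G)
    (hdom : ∀ (x : Eu d), ∀ x' ∈ s,
      ‖fderiv ℝ (fun y' => gradient (fun y => k y y' * p y) x) x'
          (EuclideanSpace.single ℓ 1)‖ ≤ G x) :
    SteinClass p (fun x => fderiv ℝ (fun y' => k x y') x'₀ (EuclideanSpace.single ℓ 1)) := by
  set e : Eu d := EuclideanSpace.single ℓ 1
  have hH : ContDiff ℝ 2 (fun z : Eu d × Eu d => k z.1 z.2 * p z.1) :=
    hk.mul ((mod_cast contDiff_infty.mp hp 2 : ContDiff ℝ 2 p).comp contDiff_fst)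
  have hkey (x : Eu d) :
      fderiv ℝ (fun y' => gradient (fun y => k y y' * p y) x) x'₀ e =
        gradient (fun y => fderiv ℝ (fun y' => k y y') x'₀ e * p y) x := by
    rw [fderiv_gradient_fst_apply hH x x'₀ e]
    congr 1
    ext u
    have hku : DifferentiableAt ℝ (fun w => k u w) x'₀ :=
      (hk.differentiable (by norm_num) (u, x'₀)).comp (f := fun w => (u, w)) x'₀ (by fun_prop)
    simp only [fderiv_mul_const hku]
    simp [mul_comm]
  have hline (t : ℝ) : HasDerivAt (fun t : ℝ => x'₀ + t • e) e t := by
    simpa using ((hasDerivAt_id t).smul_const e).const_add x'₀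
  have hs' : (fun t : ℝ => x'₀ + t • e) ⁻¹' s ∈ nhds (0 : ℝ) :=
    (hline 0).continuousAt.preimage_mem_nhds (by simpa using hs)
  have hmain := hasDerivAt_integral_of_dominated_loc_of_deriv_le (μ := volume)
    (F := fun (t : ℝ) x => gradient (fun y => k y (x'₀ + t • e) * p y) x)
    (F' := fun (t : ℝ) x =>
      fderiv ℝ (fun y' => gradient (fun y => k y y' * p y) x) (x'₀ + t • e) e)
    (x₀ := 0) (bound := G) hs'
    (.of_forall fun t => (stronglyMeasurable_gradient _).aestronglyMeasurable)
    (hstein (x'₀ + (0 : ℝ) • e) (mem_of_mem_nhds hs' :)).1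
    (by
      simp only [zero_smul, add_zero, hkey]
      exact (stronglyMeasurable_gradient _).aestronglyMeasurable)
    (.of_forall fun x t ht => hdom x _ ht) hG
    (.of_forall fun x t ht => by
      exact HasFDerivAt.comp_hasDerivAt t (hdiff x _ ht).hasFDerivAt (hline t))
  simp only [zero_smul, add_zero, hkey] at hmain
  refine ⟨hmain.1, hmain.2.unique ?_⟩
  refine (hasDerivAt_const (0 : ℝ) (0 : Eu d)).congr_of_eventuallyEq ?_
  filter_upwards [hs'] with t ht using (hstein _ ht).2
end
end

section
/- Let q be a smooth, everywhere positive density on ℝ^d with score s_q = ∇ log q. Let (λ_j) be positive reals and (e_j) smooth functions ℝ^d → ℝ, and fix x, x' ∈ ℝ^d. Suppose the series k(x,x') = Σ_j λ_j e_j(x) e_j(x') converges, and that the termwise-differentiated series also converge to the corresponding derivatives: ∇_x k(x,x') = Σ_j λ_j ∇e_j(x) e_j(x'), ∇_{x'} k(x,x') = Σ_j λ_j e_j(x) ∇e_j(x'), and tr(∇_{x,x'} k(x,x')) = Σ_j λ_j ∇e_j(x)ᵀ ∇e_j(x'). Define u_q(x,x') = s_q(x)ᵀ k(x,x') s_q(x')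 + s_q(x)ᵀ ∇_{x'}k(x,x') + ∇_x k(x,x')ᵀ s_q(x') + tr(∇_{x,x'} k(x,x')). Then u_q(x,x') = Σ_j λ_j (A_q e_j(x))ᵀ (A_q e_j(x')), where A_q e(x) = s_q(x) e(x) + ∇_x e(x), and this series converges. -/
open MeasureTheory Real
open scoped RealInnerProductSpace

noncomputable section

/-- Gradient of a two-variable kernel in its first argument. -/
def grad1 {d : ℕ} (k : Eu d → Eu d → ℝ) (x x' : Eu d) : Eu d :=
  gradient (fun y => k y x') x

/-- Gradient of a two-variable kernel in its second argument. -/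
def grad2 {d : ℕ} (k : Eu d → Eu d → ℝ) (x x' : Eu d) : Eu d :=
  gradient (fun y' => k x y') x'

/-- Trace of the matrix of mixed second partials `(∂²k/∂x_i∂x'_i)` : `tr(∇ₓ∇ₓ'k)`. -/
def trMixed {d : ℕ} (k : Eu d → Eu d → ℝ) (x x' : Eu d) : ℝ :=
  ∑ i, fderiv ℝ (fun y => grad2 k y x' i) x (EuclideanSpace.single i 1)

/-- The Stein kernel
`u_q(x,x') = s_q(x)ᵀ k s_q(x') + s_q(x)ᵀ∇ₓ'k + ∇ₓkᵀ s_q(x') + tr(∇ₓ∇ₓ'k)`. -/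
def uq {d : ℕ} (q : Eu d → ℝ) (k : Eu d → Eu d → ℝ) (x x' : Eu d) : ℝ :=
  k x x' * ⟪score q x, score q x'⟫ + ⟪score q x, grad2 k x x'⟫
    + ⟪grad1 k x x', score q x'⟫ + trMixed k x x'


/-- The Stein operator of `q` applied to a scalar function : `A_q e (x) = e(x) s_q(x) + ∇e(x)`. -/
def steinOp {d : ℕ} (q : Eu d → ℝ) (e : Eu d → ℝ) (x : Eu d) : Eu d :=
  e x • score q x + gradient e x


/-- **Spectral decomposition of the Stein kernel.** If `k(x,x') = Σ_j λ_j e_j(x) e_j(x')` and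
the termwise-differentiated series converge to the corresponding derivatives of `k`, then
`u_q(x,x') = Σ_j λ_j (A_q e_j(x))ᵀ (A_q e_j(x'))`, the series converging. -/
theorem uq_eigen_expansion {d : ℕ} (q : Eu d → ℝ)
    (hq : ContDiff ℝ (⊤ : ℕ∞) q) (hqpos : ∀ x, 0 < q x)
    (lam : ℕ → ℝ) (hlam : ∀ j, 0 < lam j)
    (e : ℕ → Eu d → ℝ) (he : ∀ j, ContDiff ℝ (⊤ : ℕ∞) (e j))
    (k : Eu d → Eu d → ℝ) (x x' : Eu d)
    (hk : HasSum (fun j => lam j * (e j x * e j x')) (k x x'))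
    (hg1 : HasSum (fun j => (lam j * e j x') • gradient (e j) x) (grad1 k x x'))
    (hg2 : HasSum (fun j => (lam j * e j x) • gradient (e j) x') (grad2 k x x'))
    (htr : HasSum (fun j => lam j * ⟪gradient (e j) x, gradient (e j) x'⟫)
      (trMixed k x x')) :
    HasSum (fun j => lam j * ⟪steinOp q (e j) x, steinOp q (e j) x'⟫) (uq q k x x') := by
  have h2 := hg2.mapL (innerSL ℝ (score q x))
  have h1 := hg1.mapL (innerSL ℝ (score q x'))
  simp only [innerSL_apply_apply] at h1 h2
  rw [real_inner_comm] at h1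
  have hsum := ((hk.mul_right ⟪score q x, score q x'⟫).add h2 |>.add h1).add htr
  refine (congrArg (HasSum · _) (funext fun j => ?_)).mpr hsum
  simp only [steinOp, inner_add_left, inner_add_right, real_inner_smul_left,
    real_inner_smul_right, real_inner_comm (gradient (e j) x) (score q x')]
  ring
end
end

section
/- Let p and q be smooth, everywhere positive probability densities on ℝ^d with scores s_p = ∇ log p and s_q = ∇ log q, set δ = s_q − s_p, and let k : ℝ^d × ℝ^d → ℝ be measurable. Assume the Fisher divergence F(p,q) = ∫ ‖δ(x)‖²₂ p(x) dx is finite, that (x,x') ↦ k(x,x')² is integrable with respect to p(x)p(x') dx dx', and that the KSD integrand is integrable. Then |S(p,q)| ≤ sqrt( ∬ k(x,x')² p(x) p(x') dx dx' ) · F(p,q), where S(p,q) = ∬ δ(x)ᵀ k(x,x') δ(x') p(x) p(x') dx dx'. -/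
open MeasureTheory Real
open scoped RealInnerProductSpace

noncomputable section

theorem memLp_two_sqrt {α : Type*} [MeasurableSpace α] {μ : Measure α} {f : α → ℝ}
    (hf : Integrable f μ) (hf0 : 0 ≤ f) : MemLp (fun x => √(f x)) 2 μ := by
  rw [memLp_two_iff_integrable_sq
    (continuous_sqrt.comp_aestronglyMeasurable hf.aestronglyMeasurable)]
  simpa only [sq_sqrt (hf0 _)] using hf

theorem integral_sqrt_mul_sqrt_le {α : Type*} [MeasurableSpace α] {μ : Measure α} {f g : α → ℝ}
    (hf : Integrable f μ) (hg : Integrable g μ) (hf0 : 0 ≤ f) (hg0 : 0 ≤ g) :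
    ∫ x, √(f x) * √(g x) ∂μ ≤ √(∫ x, f x ∂μ) * √(∫ x, g x ∂μ) := by
  have holder := integral_mul_le_Lp_mul_Lq_of_nonneg Real.HolderConjugate.two_two
    (.of_forall fun x => sqrt_nonneg (f x)) (.of_forall fun x => sqrt_nonneg (g x))
    (by simpa using memLp_two_sqrt hf hf0) (by simpa using memLp_two_sqrt hg hg0)
  simpa only [rpow_two, sq_sqrt (hf0 _), sq_sqrt (hg0 _), ← sqrt_eq_rpow] using holder

/-- **KSD is dominated by the Fisher divergence.**
`|S(p,q)| ≤ sqrt(∬ k(x,x')² p(x)p(x')) · F(p,q)`, where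
`S(p,q) = ∬ δ(x)ᵀ k(x,x') δ(x') p(x)p(x')` and `F(p,q) = ∫ ‖δ(x)‖² p(x)` with
`δ = s_q − s_p`. -/
theorem abs_ksd_le_fisher {d : ℕ} (p q : Eu d → ℝ) (k : Eu d → Eu d → ℝ)
    (hp : ContDiff ℝ (⊤ : ℕ∞) p) (hq : ContDiff ℝ (⊤ : ℕ∞) q)
    (hppos : ∀ x, 0 < p x) (hqpos : ∀ x, 0 < q x)
    (hpint : (∫ x, p x) = 1) (hqint : (∫ x, q x) = 1)
    (hk : Measurable (fun z : Eu d × Eu d => k z.1 z.2))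
    (hF : MeasureTheory.Integrable (fun x => ‖score q x - score p x‖ ^ 2 * p x))
    (hk2 : MeasureTheory.Integrable (fun z : Eu d × Eu d =>
      (k z.1 z.2) ^ 2 * (p z.1 * p z.2)) (volume.prod volume))
    (hS : MeasureTheory.Integrable (fun z : Eu d × Eu d =>
      k z.1 z.2 * ⟪score q z.1 - score p z.1, score q z.2 - score p z.2⟫ *
        (p z.1 * p z.2)) (volume.prod volume)) :
    |∫ z : Eu d × Eu d,
        k z.1 z.2 * ⟪score q z.1 - score p z.1, score q z.2 - score p z.2⟫ *
          (p z.1 * p z.2) ∂(volume.prod volume)|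
      ≤ Real.sqrt (∫ z : Eu d × Eu d, (k z.1 z.2) ^ 2 * (p z.1 * p z.2)
            ∂(volume.prod volume))
        * ∫ x, ‖score q x - score p x‖ ^ 2 * p x := by
  set A : Eu d → ℝ := fun x => ‖score q x - score p x‖ ^ 2 * p x with hA
  have hA0 : ∀ x, 0 ≤ A x := fun x => mul_nonneg (sq_nonneg _) (hppos x).le
  have hf0 : 0 ≤ fun z : Eu d × Eu d => k z.1 z.2 ^ 2 * (p z.1 * p z.2) := fun z =>
    mul_nonneg (sq_nonneg _) (mul_pos (hppos _) (hppos _)).le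
  have hg0 : 0 ≤ fun z : Eu d × Eu d => A z.1 * A z.2 := fun z => mul_nonneg (hA0 _) (hA0 _)
  have hAA : Integrable (fun z : Eu d × Eu d => A z.1 * A z.2) (volume.prod volume) :=
    hF.mul_prod hF
  have cauchy_schwarz := integral_sqrt_mul_sqrt_le hk2 hAA hf0 hg0
  rw [integral_prod_mul A A, sqrt_mul_self (integral_nonneg hA0)] at cauchy_schwarz
  refine (abs_integral_le_integral_abs.trans (integral_mono hS.abs
    ((memLp_two_sqrt hk2 hf0).integrable_mul (memLp_two_sqrt hAA hg0)) fun z => ?_)).trans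
    cauchy_schwarz
  have hw := mul_pos (hppos z.1) (hppos z.2)
  have hAz : A z.1 * A z.2 =
      (‖score q z.1 - score p z.1‖ * ‖score q z.2 - score p z.2‖) ^ 2 * (p z.1 * p z.2) := by
    simp only [hA]; ring
  simp only [Pi.mul_apply]
  rw [hAz, sqrt_mul (sq_nonneg _), sqrt_mul (sq_nonneg _), sqrt_sq_eq_abs,
    sqrt_sq (by positivity), mul_mul_mul_comm |k z.1 z.2|, mul_self_sqrt hw.le, abs_mul, abs_mul,
    abs_of_pos hw]
  gcongr
  exact abs_real_inner_le_norm _ _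
end
end

section
/- Let p and q be smooth, everywhere positive probability densities on ℝ^d with scores s_p = ∇ log p and s_q = ∇ log q, with Fisher divergence F(p,q) = ∫ ‖s_q(x) − s_p(x)‖²₂ p(x) dx finite. Let f : ℝ^d → ℝ^d be a smooth vector-valued function each of whose components is in the Stein class of p, such that ∫ ‖f(x)‖²₂ p(x) dx ≤ 1 and the integrand below is integrable. Then ∫_{ℝ^d} ( s_q(x)ᵀ f(x) + div_x f(x) ) p(x) dx ≤ sqrt(F(p,q)). -/
open MeasureTheory Real
open scoped RealInnerProductSpace

noncomputable section

lemma differentiable_component {d : ℕ} {f : Eu d → Eu d} (hf : Differentiable ℝ f) (ℓ : Fin d) :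
    Differentiable ℝ (fun y => f y ℓ) :=
  (EuclideanSpace.proj (𝕜 := ℝ) ℓ).differentiable.comp hf

/-- The Stein operator of `p` times `p` is the divergence of `p • f`. -/
lemma inner_score_add_diverg_mul {d : ℕ} {p : Eu d → ℝ} {f : Eu d → Eu d}
    (hp : Differentiable ℝ p) (hf : Differentiable ℝ f) {x : Eu d} (hx : p x ≠ 0) :
    (⟪score p x, f x⟫ + diverg f x) * p x
      = ∑ ℓ, gradient (fun y => f y ℓ * p y) x ℓ := by
  have hfℓ := differentiable_component hf
  rw [PiLp.inner_apply, diverg, ← Finset.sum_add_distrib, Finset.sum_mul]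
  refine Finset.sum_congr rfl fun ℓ _ => ?_
  rw [score, gradient_apply_eq_fderiv_single, gradient_apply_eq_fderiv_single,
    fderiv_fun_mul (hfℓ ℓ x) (hp x), fderiv.log (hp x) hx]
  simp only [add_apply, smul_apply, smul_eq_mul,
    RCLike.inner_apply, conj_trivial]
  field_simp

/-- Stein's identity: the integrand is integrable with zero mean. -/
lemma SteinClass.integrable_sum_and_integral_eq_zero {d : ℕ} {p : Eu d → ℝ} {f : Eu d → Eu d}
    (h : ∀ ℓ : Fin d, SteinClass p (fun x => f x ℓ)) :
    Integrable (fun x => ∑ ℓ, gradient (fun y => f y ℓ * p y) x ℓ) ∧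
      ∫ x, ∑ ℓ, gradient (fun y => f y ℓ * p y) x ℓ = 0 := by
  have hi : ∀ ℓ : Fin d, Integrable (fun x => gradient (fun y => f y ℓ * p y) x ℓ) :=
    fun ℓ => (EuclideanSpace.proj (𝕜 := ℝ) ℓ).integrable_comp (h ℓ).1
  refine ⟨integrable_finsetSum _ fun ℓ _ => hi ℓ, ?_⟩
  rw [integral_finsetSum _ fun ℓ _ => hi ℓ]
  refine Finset.sum_eq_zero fun ℓ _ => ?_
  have := (EuclideanSpace.proj (𝕜 := ℝ) ℓ).integral_comp_comm (h ℓ).1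
  rw [(h ℓ).2] at this
  simpa using this

lemma real_inner_le_weighted_sq {E : Type*} [NormedAddCommGroup E] [InnerProductSpace ℝ E]
    (u v : E) {t : ℝ} (ht : 0 < t) :
    ⟪u, v⟫ ≤ t / 2 * ‖v‖ ^ 2 + 1 / (2 * t) * ‖u‖ ^ 2 := by
  refine (real_inner_le_norm u v).trans ?_
  have h : t / 2 * ‖v‖ ^ 2 + 1 / (2 * t) * ‖u‖ ^ 2 - ‖u‖ * ‖v‖
      = 1 / (2 * t) * (t * ‖v‖ - ‖u‖) ^ 2 := by
    field_simp
    ring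
  have : 0 ≤ 1 / (2 * t) * (t * ‖v‖ - ‖u‖) ^ 2 := by positivity
  linarith

/-- **Variational bound by the Fisher divergence.** For any smooth vector field `f` whose
components are in the Stein class of `p` and with `∫ ‖f‖² p ≤ 1`,
`∫ (s_qᵀ f + div f) p ≤ sqrt(F(p,q))`. -/
theorem stein_expectation_le_sqrt_fisher {d : ℕ} (p q : Eu d → ℝ) (f : Eu d → Eu d)
    (hp : ContDiff ℝ (⊤ : ℕ∞) p) (hq : ContDiff ℝ (⊤ : ℕ∞) q)
    (hppos : ∀ x, 0 < p x) (hqpos : ∀ x, 0 < q x)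
    (hpint : (∫ x, p x) = 1) (hqint : (∫ x, q x) = 1)
    (hF : MeasureTheory.Integrable (fun x => ‖score q x - score p x‖ ^ 2 * p x))
    (hf : ContDiff ℝ (⊤ : ℕ∞) f)
    (hfstein : ∀ ℓ : Fin d, SteinClass p (fun x => f x ℓ))
    (hfL2 : MeasureTheory.Integrable (fun x => ‖f x‖ ^ 2 * p x))
    (hfball : (∫ x, ‖f x‖ ^ 2 * p x) ≤ 1)
    (hint : MeasureTheory.Integrable (fun x => (⟪score q x, f x⟫ + diverg f x) * p x)) :
    (∫ x, (⟪score q x, f x⟫ + diverg f x) * p x)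
      ≤ Real.sqrt (∫ x, ‖score q x - score p x‖ ^ 2 * p x) := by
  have hpd : Differentiable ℝ p := hp.differentiable (by simp)
  have hfd : Differentiable ℝ f := hf.differentiable (by simp)
  obtain ⟨hSi, hS0⟩ := SteinClass.integrable_sum_and_integral_eq_zero hfstein
  set A := ∫ x, ‖score q x - score p x‖ ^ 2 * p x with hA
  have hA0 : 0 ≤ A := integral_nonneg fun x => mul_nonneg (by positivity) (hppos x).le
  have key : ∀ t : ℝ, 0 < t →
      (∫ x, (⟪score q x, f x⟫ + diverg f x) * p x) ≤ t / 2 + 1 / (2 * t) * A := by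
    intro t ht
    have hf' := hfL2.const_mul (t / 2)
    have hF' := hF.const_mul (1 / (2 * t))
    have hle := integral_mono hint (hSi.add (hf'.add hF')) fun x => by
      have h1 := inner_score_add_diverg_mul hpd hfd (hppos x).ne'
      have h2 := mul_le_mul_of_nonneg_right
        (real_inner_le_weighted_sq (score q x - score p x) (f x) ht) (hppos x).le
      rw [inner_sub_left] at h2
      simp only [Pi.add_apply]
      rw [← h1]
      linarith
    rw [integral_add' hSi (hf'.add hF'), integral_add' hf' hF', hS0, integral_const_mul,
      integral_const_mul, ← hA] at hle
    have := mul_le_mul_of_nonneg_left hfball (half_pos ht).le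
    linarith
  refine le_of_forall_pos_le_add fun ε hε => ?_
  have hs : 0 ≤ √A := Real.sqrt_nonneg A
  refine (key (√A + ε) (by positivity)).trans ?_
  have h : 1 / (2 * (√A + ε)) * A ≤ √A / 2 := by
    rw [one_div_mul_eq_div, div_le_div_iff₀ (by positivity) two_pos]
    nlinarith [Real.sq_sqrt hA0, mul_nonneg hs hε.le]
  linarith
end
end
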